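/- Let A be an associative unital ℝ-algebra and let (Γ_a)_{a=0}^{10} satisfy the 11d Clifford relations together with the volume normalization Γ₀ Γ₁ ⋯ Γ₁₀ = 1. Then for every p with 1 ≤ p ≤ 11 and every tuple (a₁,…,a_p) of indices in {0,…,10}: Γ^{a₁⋯a_p} = ((−1)^{(p+1)(p−2)/2} / (11−p)!) · Σ_{b₁,…,b_{11−p}=0}^{10} ε^{a₁⋯a_p b₁⋯b_{11−p}} Γ_{b₁⋯b_{11−p}}. -/

import Mathlib

open Matrix BigOperators

noncomputable section

/-- The 11×11 Minkowski metric `η = diag(−1,+1,…,+1)`. -/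
def eta (a b : Fin 11) : ℝ :=
  if a = b then (if a = 0 then -1 else 1) else 0

/-- The 11d Clifford relations `Γ_a Γ_b + Γ_b Γ_a = 2 η_{ab} · 1`. -/
def CliffordRel {A : Type*} [Ring A] [Algebra ℝ A] (Γ : Fin 11 → A) : Prop :=
  ∀ a b : Fin 11, Γ a * Γ b + Γ b * Γ a = (2 * eta a b) • (1 : A)

/-- The antisymmetrized Clifford element
`Γ_{a₁⋯a_p} = (1/p!) Σ_{σ ∈ S_p} sgn(σ) Γ_{a_{σ(1)}} ⋯ Γ_{a_{σ(p)}}`. -/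
def gammaA {A : Type*} [Ring A] [Algebra ℝ A] (Γ : Fin 11 → A) (p : ℕ)
    (a : Fin p → Fin 11) : A :=
  (p.factorial : ℝ)⁻¹ • ∑ σ : Equiv.Perm (Fin p),
    ((Equiv.Perm.sign σ : ℤ) : ℝ) • (List.ofFn fun i => Γ (a (σ i))).prod

/-- The Levi-Civita symbol (lower indices): the sign of `(a₁,…,a₁₁)` as a permutation
of `(0,…,10)`, and `0` if two indices coincide; in particular `ε_{0 1 ⋯ 10} = +1`. -/
def epsL (a : Fin 11 → Fin 11) : ℝ :=
  ∑ σ : Equiv.Perm (Fin 11),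
    if (∀ i, a i = σ i) then ((Equiv.Perm.sign σ : ℤ) : ℝ) else 0
/-- The index-raised antisymmetrized Clifford element
`Γ^{a₁⋯a_p} = Σ_b η^{a₁b₁} ⋯ η^{a_pb_p} Γ_{b₁⋯b_p}`. -/
def gammaU {A : Type*} [Ring A] [Algebra ℝ A] (Γ : Fin 11 → A) (p : ℕ)
    (a : Fin p → Fin 11) : A :=
  ∑ b : Fin p → Fin 11, (∏ i, eta (a i) (b i)) • gammaA Γ p b

/-- The Levi-Civita symbol with all indices raised by `η`; `ε^{0 1 ⋯ 10} = −1`. -/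
def epsU (a : Fin 11 → Fin 11) : ℝ :=
  ∑ b : Fin 11 → Fin 11, (∏ i, eta (a i) (b i)) * epsL b

theorem prod_ofFn_comp_adjacent_swap {A : Type*} [Ring A] {n : ℕ} (g : Fin (n + 1) → A)
    (hg : ∀ i j, i ≠ j → g i * g j = -(g j * g i)) (i : Fin n) :
    (List.ofFn (g ∘ Equiv.swap i.castSucc i.succ)).prod = -(List.ofFn g).prod := by
  induction n with
  | zero => exact i.elim0
  | succ n ih =>
    cases i using Fin.cases with
    | zero =>
      have htail : ∀ k : Fin n, Equiv.swap (0 : Fin (n + 2)) 1 k.succ.succ = k.succ.succ :=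
        fun k => Equiv.swap_apply_of_ne_of_ne (Fin.succ_ne_zero _)
          (fun h => Fin.succ_ne_zero k (Fin.succ_injective _ h))
      simp [List.ofFn_succ, htail, ← mul_assoc, hg 1 0 (by simp)]
    | succ j =>
      have hzero : Equiv.swap j.succ.castSucc j.succ.succ 0 = 0 :=
        Equiv.swap_apply_of_ne_of_ne (by simp [Fin.ext_iff]) (by simp [Fin.ext_iff])
      have hsucc : (fun k : Fin (n + 1) => g (Equiv.swap j.succ.castSucc j.succ.succ k.succ))
          = (g ∘ Fin.succ) ∘ Equiv.swap j.castSucc j.succ := by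
        funext k
        simp only [Function.comp_apply, ← Fin.succ_castSucc]
        rw [(Fin.succ_injective _).map_swap]
      have htail := ih (g ∘ Fin.succ)
        (fun k l hkl => hg _ _ ((Fin.succ_injective _).ne hkl)) j
      rw [← hsucc] at htail
      rw [List.ofFn_succ, List.ofFn_succ (f := g)]
      simp only [Function.comp_apply, List.prod_cons, hzero, htail, mul_neg]
      rfl

/-- Permuting a product of pairwise anticommuting elements multiplies it by the sign. -/
theorem prod_ofFn_comp_perm {A : Type*} [Ring A] {n : ℕ} (g : Fin n → A)
    (hg : ∀ i j, i ≠ j → g i * g j = -(g j * g i)) (σ : Equiv.Perm (Fin n)) :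
    (List.ofFn (g ∘ σ)).prod = (Equiv.Perm.sign σ : ℤ) • (List.ofFn g).prod := by
  cases n with
  | zero => simp [Subsingleton.elim σ 1]
  | succ n =>
    have hσ : σ ∈ Submonoid.closure
        (Set.range fun i : Fin n => Equiv.swap i.castSucc i.succ) := by
      rw [Equiv.Perm.mclosure_swap_castSucc_succ]
      trivial
    induction hσ using Submonoid.closure_induction_right with
    | one => simp
    | mul_right τ _ s hs ih =>
      obtain ⟨i, rfl⟩ := hs
      have hswap := prod_ofFn_comp_adjacent_swap (g ∘ τ)
        (fun k l hkl => hg _ _ (τ.injective.ne hkl)) i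
      rw [Equiv.Perm.coe_mul, ← Function.comp_assoc, hswap, ih]
      simp [Equiv.Perm.sign_swap i.castSucc_lt_succ.ne]

theorem prod_ofFn_mul_of_anticomm {A : Type*} [Ring A] {n : ℕ} (x : A) (g : Fin n → A)
    (hg : ∀ i, g i * x = -(x * g i)) :
    (List.ofFn g).prod * x = (-1) ^ n * (x * (List.ofFn g).prod) := by
  induction n with
  | zero => simp
  | succ n ih =>
    rw [List.ofFn_succ, List.prod_cons, mul_assoc, ih _ fun i => hg i.succ]
    have hc : Commute (g 0) ((-1) ^ n) := (Commute.neg_one_right _).pow_right n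
    rw [← mul_assoc (g 0), hc.eq, mul_assoc, ← mul_assoc (g 0), hg 0, pow_succ]
    simp [mul_assoc]

section Clifford

variable {A : Type*} [Ring A] [Algebra ℝ A]

/-- The square of a product of `n` anticommuting elements with scalar squares `c i`. -/
theorem prod_ofFn_mul_self {n : ℕ} (g : Fin n → A) (c : Fin n → ℝ)
    (hg : ∀ i j, i ≠ j → g i * g j = -(g j * g i)) (hc : ∀ i, g i * g i = c i • (1 : A)) :
    (List.ofFn g).prod * (List.ofFn g).prod
      = ((-1 : ℝ) ^ n.choose 2 * ∏ i, c i) • (1 : A) := by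
  induction n with
  | zero => simp
  | succ n ih =>
    have hswap := prod_ofFn_mul_of_anticomm (g 0) (fun i : Fin n => g i.succ)
      fun i => hg _ _ (Fin.succ_ne_zero i)
    have htail := ih (fun i => g i.succ) (fun i => c i.succ)
      (fun i j hij => hg _ _ ((Fin.succ_injective _).ne hij)) fun i => hc _
    rw [List.ofFn_succ, List.prod_cons]
    set T := (List.ofFn fun i : Fin n => g i.succ).prod
    have hcomm : Commute (g 0) ((-1) ^ n) := (Commute.neg_one_right _).pow_right n
    have hpow : ((-1 : A) ^ n) = ((-1 : ℝ) ^ n) • (1 : A) := by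
      rw [← Algebra.algebraMap_eq_smul_one]; simp
    calc g 0 * T * (g 0 * T) = g 0 * (T * g 0) * T := by simp only [mul_assoc]
      _ = (-1) ^ n * ((g 0 * g 0) * (T * T)) := by
        rw [hswap, ← mul_assoc (g 0), hcomm.eq]; simp only [mul_assoc]
      _ = _ := by
        rw [hc, htail, hpow, Fin.prod_univ_succ, Nat.choose_succ_succ' n 1, Nat.choose_one_right]
        simp only [smul_mul_smul_comm, mul_one]
        congr 1
        ring

theorem CliffordRel.anticomm {Γ : Fin 11 → A} (hC : CliffordRel Γ) {a b : Fin 11}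
    (h : a ≠ b) : Γ a * Γ b = -(Γ b * Γ a) := by
  have := hC a b
  rw [eta, if_neg h, mul_zero, zero_smul] at this
  exact eq_neg_of_add_eq_zero_left this

theorem CliffordRel.mul_self {Γ : Fin 11 → A} (hC : CliffordRel Γ) (a : Fin 11) :
    Γ a * Γ a = eta a a • (1 : A) := by
  have h := hC a a
  rw [← two_smul ℝ, mul_smul] at h
  exact smul_right_injective A (two_ne_zero (α := ℝ)) h

theorem eta_self_mul_self (a : Fin 11) : eta a a * eta a a = 1 := by
  rw [eta, if_pos rfl]; split_ifs <;> norm_num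

theorem prod_eta_eq_zero {p : ℕ} {a b : Fin p → Fin 11} (h : b ≠ a) :
    ∏ i, eta (a i) (b i) = 0 := by
  obtain ⟨i, hi⟩ := Function.ne_iff.mp h
  exact Finset.prod_eq_zero (Finset.mem_univ i) (if_neg hi.symm)

theorem gammaU_eq (Γ : Fin 11 → A) (p : ℕ) (a : Fin p → Fin 11) :
    gammaU Γ p a = (∏ i, eta (a i) (a i)) • gammaA Γ p a :=
  Fintype.sum_eq_single a fun b hb => by rw [prod_eta_eq_zero hb, zero_smul]

theorem epsL_perm (σ : Equiv.Perm (Fin 11)) : epsL σ = ((Equiv.Perm.sign σ : ℤ) : ℝ) := by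
  rw [epsL, Fintype.sum_eq_single σ]
  · simp
  · intro τ hτ
    exact if_neg fun h => hτ (Equiv.ext fun i => (h i).symm)

theorem epsL_eq_zero {a : Fin 11 → Fin 11} (h : ¬ Function.Injective a) : epsL a = 0 :=
  Finset.sum_eq_zero fun σ _ => if_neg fun hσ => h ((funext hσ : a = σ) ▸ σ.injective)

theorem epsU_eq_neg_epsL (a : Fin 11 → Fin 11) : epsU a = -epsL a := by
  have hdiag : epsU a = (∏ i, eta (a i) (a i)) * epsL a :=
    Fintype.sum_eq_single a fun b hb => by rw [prod_eta_eq_zero hb, zero_mul]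
  rw [hdiag]
  by_cases h : Function.Injective a
  · have hprod : ∏ i, eta (a i) (a i) = ∏ i, eta i i :=
      (Finite.injective_iff_bijective.mp h).prod_comp fun i => eta i i
    rw [hprod]
    simp [eta]
  · simp [epsL_eq_zero h]

theorem gammaA_eq_prod {Γ : Fin 11 → A} (hC : CliffordRel Γ) {p : ℕ} {a : Fin p → Fin 11}
    (ha : Function.Injective a) : gammaA Γ p a = (List.ofFn (Γ ∘ a)).prod := by
  have hterm : ∀ σ : Equiv.Perm (Fin p),
      ((Equiv.Perm.sign σ : ℤ) : ℝ) • (List.ofFn fun i => Γ (a (σ i))).prod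
        = (List.ofFn (Γ ∘ a)).prod := by
    intro σ
    have h := prod_ofFn_comp_perm (Γ ∘ a) (fun i j hij => hC.anticomm (ha.ne hij)) σ
    change (List.ofFn fun i => Γ (a (σ i))).prod = _ at h
    rw [h, ← Int.cast_smul_eq_zsmul ℝ, smul_smul, ← Int.cast_mul, ← Units.val_mul,
      Int.units_mul_self]
    simp
  rw [gammaA, Finset.sum_congr rfl fun σ _ => hterm σ, Finset.sum_const, Finset.card_univ,
    Fintype.card_perm, Fintype.card_fin, ← Nat.cast_smul_eq_nsmul ℝ, smul_smul,
    inv_mul_cancel₀ (Nat.cast_ne_zero.mpr p.factorial_ne_zero), one_smul]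

theorem gammaA_eq_zero (Γ : Fin 11 → A) {p : ℕ} {a : Fin p → Fin 11}
    (ha : ¬ Function.Injective a) : gammaA Γ p a = 0 := by
  simp only [Function.Injective, not_forall] at ha
  obtain ⟨i, j, hij, hne⟩ := ha
  have hswap : ∀ k, a (Equiv.swap i j k) = a k := by
    intro k
    rw [Equiv.swap_apply_def]
    split_ifs with h₁ h₂
    · rw [h₁, hij]
    · rw [h₂, hij]
    · rfl
  rw [gammaA, Finset.sum_involution (fun σ _ => Equiv.swap i j * σ), smul_zero]
  · intro σ _
    simp [hswap, Equiv.Perm.sign_swap hne]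
  · intro σ _ _ h
    exact hne (Equiv.swap_eq_one_iff.mp (mul_eq_right.mp h))
  · simp
  · intro σ _
    simp

end Clifford

theorem prod_ofFn_append_comp_cast {M : Type*} [Monoid M] {α : Type*} {n p q : ℕ}
    (f : α → M) (a : Fin p → α) (b : Fin q → α) (h : n = p + q) :
    (List.ofFn (f ∘ Fin.append a b ∘ Fin.cast h)).prod
      = (List.ofFn (f ∘ a)).prod * (List.ofFn (f ∘ b)).prod := by
  subst h
  rw [← List.prod_append, ← List.ofFn_fin_append]
  congr 2
  funext i
  refine Fin.addCases (fun i => ?_) (fun i => ?_) i <;> simp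

/-- Complementary products of gamma matrices are dual to each other. -/
theorem epsL_append_smul_gammaA {A : Type*} [Ring A] [Algebra ℝ A] {Γ : Fin 11 → A}
    (hC : CliffordRel Γ)
    (hV : (List.ofFn Γ).prod = 1) {p q : ℕ} {a : Fin p → Fin 11} {b : Fin q → Fin 11}
    (h : 11 = p + q) (hab : Function.Injective (Fin.append a b)) :
    epsL (Fin.append a b ∘ Fin.cast h) • gammaA Γ q b
      = ((-1 : ℝ) ^ p.choose 2 * ∏ i, eta (a i) (a i)) • gammaA Γ p a := by
  obtain ⟨ha, hb, -⟩ := Fin.append_injective_iff.mp hab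
  have hbij : Function.Bijective (Fin.append a b ∘ Fin.cast h) :=
    Finite.injective_iff_bijective.mp (hab.comp (Fin.cast_injective h))
  obtain ⟨σ, hσ⟩ : ∃ σ : Equiv.Perm (Fin 11), ⇑σ = Fin.append a b ∘ Fin.cast h :=
    ⟨Equiv.ofBijective _ hbij, rfl⟩
  have hprod := prod_ofFn_append_comp_cast Γ a b h
  rw [← hσ, prod_ofFn_comp_perm Γ (fun i j hij => hC.anticomm hij), hV,
    ← Int.cast_smul_eq_zsmul ℝ] at hprod
  have hsq := prod_ofFn_mul_self (Γ ∘ a) (fun i => eta (a i) (a i))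
    (fun i j hij => hC.anticomm (ha.ne hij)) fun i => hC.mul_self (a i)
  rw [← hσ, epsL_perm, gammaA_eq_prod hC ha, gammaA_eq_prod hC hb]
  set s : ℝ := ((Equiv.Perm.sign σ : ℤ) : ℝ)
  set c : ℝ := (-1 : ℝ) ^ p.choose 2 * ∏ i, eta (a i) (a i)
  set P := (List.ofFn (Γ ∘ a)).prod
  set Q := (List.ofFn (Γ ∘ b)).prod
  have hs : s * s = 1 := by
    rw [← Int.cast_mul, ← Units.val_mul, Int.units_mul_self]; simp
  have hc : c * c = 1 := by
    rw [mul_mul_mul_comm, ← mul_pow, ← Finset.prod_mul_distrib]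
    simp [eta_self_mul_self]
  have hPQ : s • P = c • Q := by
    calc s • P = P * (s • (1 : A)) := by simp
      _ = P * P * Q := by rw [hprod, mul_assoc]
      _ = c • Q := by rw [hsq, smul_one_mul]
  calc s • Q = s • c • c • Q := by rw [smul_smul c, hc, one_smul]
    _ = c • (s * s) • P := by rw [← hPQ, smul_comm s c, smul_smul s s]
    _ = c • P := by rw [hs, one_smul]

theorem card_filter_append_injective {α : Type*} [Fintype α] [DecidableEq α] {p q : ℕ}
    {a : Fin p → α} (ha : Function.Injective a) :
    (Finset.univ.filter fun b : Fin q → α => Function.Injective (Fin.append a b)).card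
      = (Fintype.card α - p).descFactorial q := by
  classical
  let e : {b : Fin q → α // Function.Injective (Fin.append a b)}
      ≃ (Fin q ↪ {x // x ∉ Set.range a}) :=
    { toFun := fun b =>
        ⟨fun j => ⟨b.1 j, fun ⟨i, hi⟩ => (Fin.append_injective_iff.mp b.2).2.2 i j hi⟩,
          fun _ _ hij => (Fin.append_injective_iff.mp b.2).2.1 (Subtype.ext_iff.mp hij)⟩
      invFun := fun f =>
        ⟨fun j => f j, Fin.append_injective_iff.mpr
          ⟨ha, Subtype.val_injective.comp f.injective, fun i j hij => (f j).2 ⟨i, hij⟩⟩⟩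
      left_inv := fun _ => rfl
      right_inv := fun _ => rfl }
  rw [← Fintype.card_subtype, Fintype.card_congr e, Fintype.card_embedding_eq,
    Fintype.card_subtype_compl, Fintype.card_fin]
  congr 2
  exact (Set.card_range_of_injective ha).trans (Fintype.card_fin p)

theorem neg_one_zpow_hodge (p : ℕ) :
    (-1 : ℝ) ^ ((((p : ℤ) + 1) * ((p : ℤ) - 2)) / 2) = -(-1) ^ p.choose 2 := by
  have hchoose : (p : ℤ) * (p - 1) = 2 * p.choose 2 := by
    induction p with
    | zero => simp
    | succ n ih =>
      rw [Nat.choose_succ_succ' n 1, Nat.choose_one_right]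
      push_cast
      linarith
  have hexp : (((p : ℤ) + 1) * ((p : ℤ) - 2)) / 2 = (p.choose 2 : ℤ) - 1 :=
    Int.ediv_eq_of_eq_mul_right two_ne_zero (by linarith)
  rw [hexp, zpow_sub₀ (by norm_num), zpow_natCast, zpow_one, div_neg, div_one]

/-- Hodge duality for Clifford basis elements: for `1 ≤ p ≤ 11`,
`Γ^{a₁⋯a_p} = ((−1)^{(p+1)(p−2)/2}/(11−p)!) Σ_b ε^{a₁⋯a_p b₁⋯b_{11−p}} Γ_{b₁⋯b_{11−p}}`. -/
theorem gammaU_hodge_duality {A : Type*} [Ring A] [Algebra ℝ A]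
    (Γ : Fin 11 → A) (hC : CliffordRel Γ) (hV : (List.ofFn Γ).prod = 1)
    (p : ℕ) (hp1 : 1 ≤ p) (hp : p ≤ 11) (a : Fin p → Fin 11) :
    gammaU Γ p a
      = (((-1 : ℝ) ^ ((((p : ℤ) + 1) * ((p : ℤ) - 2)) / 2)
            / ((11 - p).factorial : ℝ)) : ℝ) •
        ∑ b : Fin (11 - p) → Fin 11,
          epsU (Fin.append a b ∘ Fin.cast (by omega : (11 : ℕ) = p + (11 - p))) •
            gammaA Γ (11 - p) b := by
  classical
  have h11 : 11 = p + (11 - p) := by omega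
  rw [gammaU_eq]
  by_cases ha : Function.Injective a
  · set c : ℝ := (-1 : ℝ) ^ p.choose 2 * ∏ i, eta (a i) (a i) with hc
    have hterm : ∀ b : Fin (11 - p) → Fin 11,
        epsU (Fin.append a b ∘ Fin.cast h11) • gammaA Γ (11 - p) b
          = if Function.Injective (Fin.append a b) then -(c • gammaA Γ p a) else 0 := by
      intro b
      rw [epsU_eq_neg_epsL]
      split_ifs with hab
      · rw [neg_smul, epsL_append_smul_gammaA hC hV h11 hab]
      · rw [epsL_eq_zero, neg_zero, zero_smul]
        exact fun hinj => hab <|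
          (Function.Injective.of_comp_iff' _ (finCongr h11).bijective).mp hinj
    rw [Finset.sum_congr rfl fun b _ => hterm b, ← Finset.sum_filter, Finset.sum_const,
      card_filter_append_injective ha, Fintype.card_fin, Nat.descFactorial_self,
      ← Nat.cast_smul_eq_nsmul ℝ, neg_one_zpow_hodge, smul_smul,
      div_mul_cancel₀ _ (Nat.cast_ne_zero.mpr (Nat.factorial_ne_zero _)), smul_neg, neg_smul,
      neg_neg, smul_smul, hc, ← mul_assoc, ← mul_pow]
    simp
  · rw [gammaA_eq_zero Γ ha, smul_zero, Finset.sum_eq_zero, smul_zero]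
    intro b _
    rw [epsU_eq_neg_epsL, epsL_eq_zero, neg_zero, zero_smul]
    exact fun hinj => ha (Fin.append_injective_iff.mp
      ((Function.Injective.of_comp_iff' _ (finCongr h11).bijective).mp hinj)).1

end
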